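/- Assume W is a double-well potential (W ∈ C¹(ℝ), W(-1) = W(1) = 0, W(s) > 0 for s ≠ ±1) and a : ℝ → ℝ is measurable. Fix ε > 0 and set β_ε = min{ W(s) : 1 − ε ≤ s ≤ 1 − ε/2 or −1 + ε/2 ≤ s ≤ −1 + ε }. If u ∈ X₁ and there exist t₁, t₂ ∈ ℝ with u(t₁) = 1 − ε and u(t₂) = 1 − ε/2 (or u(t₁) = −1 + ε/2 and u(t₂) = −1 + ε), and a₁ := inf_{t ∈ [t₁,t₂]} a(t) > 0, then L_a(u) ≥ |∫_{t₁}^{t₂} (1 − √(1 − |u'|²) + a(t) W(u)) dt| ≥ ε √(a₁ β_ε) / √2. -/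

import Mathlib

open MeasureTheory Filter Topology Set
open scoped ENNReal

noncomputable section

/-- The class `X₁`: `W^{1,∞}(ℝ)` functions with `‖u'‖_{L^∞} ≤ 1` and `u(t) → ±1` as
`t → ±∞`. -/
def memX1 (u : ℝ → ℝ) : Prop :=
  LipschitzWith 1 u ∧ Tendsto u atTop (𝓝 (1:ℝ)) ∧ Tendsto u atBot (𝓝 (-1:ℝ))

/-- `W` is a double-well potential: `C¹`, vanishing exactly at `±1` and positive elsewhere. -/
def DoubleWell (W : ℝ → ℝ) : Prop :=
  ContDiff ℝ 1 W ∧ W (-1) = 0 ∧ W 1 = 0 ∧ ∀ s : ℝ, s ≠ -1 → s ≠ 1 → 0 < W s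

/-- The action functional `L_a(u) = ∫_ℝ (1 - √(1 - |u'|²) + a(t) W(u)) dt`. -/
def LaE (a W u : ℝ → ℝ) : ℝ≥0∞ :=
  ∫⁻ t : ℝ, ENNReal.ofReal (1 - Real.sqrt (1 - (deriv u t) ^ 2) + a t * W (u t))

/-- `u` is a `C¹ ∩ W^{2,2}_loc` solution of `(u'/√(1-|u'|²))' = a(t) W'(u)` on `ℝ`,
expressed through the integrated form of the equation. -/
def SolvesEL (a W u : ℝ → ℝ) : Prop :=
  ContDiff ℝ 1 u ∧
  ∀ s t : ℝ,
    deriv u t / Real.sqrt (1 - (deriv u t) ^ 2)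
      - deriv u s / Real.sqrt (1 - (deriv u s) ^ 2)
    = ∫ r in s..t, a r * deriv W (u r)

/-- If `g` is pointwise less oscillating than `f`, its derivative is no larger. -/
lemma abs_deriv_le_abs_deriv_of_abs_sub_le {f g : ℝ → ℝ} {t : ℝ} (hf : DifferentiableAt ℝ f t)
    (h : ∀ s, |g s - g t| ≤ |f s - f t|) : |deriv g t| ≤ |deriv f t| := by
  by_cases hg : DifferentiableAt ℝ g t
  · refine le_of_tendsto_of_tendsto (hasDerivAt_iff_tendsto_slope.1 hg.hasDerivAt).abs
      (hasDerivAt_iff_tendsto_slope.1 hf.hasDerivAt).abs (Eventually.of_forall fun s => ?_)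
    simp only [slope_def_field, abs_div]
    exact div_le_div_of_nonneg_right (h s) (abs_nonneg _)
  · simp [deriv_zero_of_not_differentiableAt hg]

lemma abs_clamp_sub_clamp_le (c d x y : ℝ) :
    |max c (min d x) - max c (min d y)| ≤ |x - y| := by
  grind

lemma deriv_clamp_eq_zero_of_notMem {u : ℝ → ℝ} (hu : Continuous u) {c d t : ℝ} (hcd : c ≤ d)
    (ht : u t ∉ Icc c d) : deriv (fun s => max c (min d (u s))) t = 0 := by
  rcases lt_or_ge (u t) c with h | h
  · have : (fun s => max c (min d (u s))) =ᶠ[𝓝 t] fun _ => c := by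
      filter_upwards [hu.continuousAt.eventually_lt_const h] with s hs
      exact max_eq_left ((min_le_right _ _).trans hs.le)
    rw [this.deriv_eq, deriv_const]
  · have h' : d < u t := by
      by_contra! h'
      exact ht ⟨h, h'⟩
    have : (fun s => max c (min d (u s))) =ᶠ[𝓝 t] fun _ => d := by
      filter_upwards [hu.continuousAt.eventually_const_lt h'] with s hs
      rw [min_eq_left hs.le, max_eq_right hcd]
    rw [this.deriv_eq, deriv_const]

/-- The variation of a Lipschitz function between two points is at most the integral of `|v'|`. -/
lemma LipschitzWith.ofReal_abs_sub_le_lintegral_deriv {v : ℝ → ℝ} {K : NNReal}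
    (hv : LipschitzWith K v) (x y : ℝ) :
    ENNReal.ofReal |v y - v x| ≤ ∫⁻ t in uIcc x y, ENNReal.ofReal |deriv v t| := by
  rw [← (hv.lipschitzOnWith (s := uIcc x y)).absolutelyContinuousOnInterval.integral_deriv_eq_sub,
    ← Real.norm_eq_abs, intervalIntegral.norm_intervalIntegral_eq, ofReal_norm]
  refine (enorm_integral_le_lintegral_enorm _).trans ?_
  refine (lintegral_mono_set uIoc_subset_uIcc).trans (le_of_eq ?_)
  simp only [← Real.norm_eq_abs, ofReal_norm]

lemma sqrt_two_mul_mul_le_lagrangian {p m : ℝ} (hp : |p| ≤ 1) (hm : 0 ≤ m) :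
    √(2 * m) * |p| ≤ 1 - √(1 - p ^ 2) + m := by
  have hp2 : p ^ 2 ≤ 1 := (sq_le_one_iff_abs_le_one p).2 hp
  have h1 : √(1 - p ^ 2) ≤ 1 - p ^ 2 / 2 :=
    Real.sqrt_le_iff.2 ⟨by linarith, by nlinarith [sq_nonneg (p ^ 2)]⟩
  have h2 : √(2 * m) ^ 2 = 2 * m := Real.sq_sqrt (by positivity)
  nlinarith [sq_nonneg (√(2 * m) - |p|), sq_abs p]

/-- Crossing a level band `[c, d]` on which `W ≥ β`, during a time interval on which `a ≥ α`,
costs at least `(d - c) √(2 α β)`. -/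
lemma ofReal_crossing_cost_le {W a u : ℝ → ℝ} {α β c d t₁ t₂ : ℝ} (hu : LipschitzWith 1 u)
    (hW : ∀ s, 0 ≤ W s) (hα : 0 ≤ α) (hβ : 0 ≤ β) (ha : ∀ t ∈ uIcc t₁ t₂, α ≤ a t)
    (hWβ : ∀ s ∈ Icc c d, β ≤ W s) (hcd : c ≤ d) (h₁ : u t₁ = c) (h₂ : u t₂ = d) :
    ENNReal.ofReal (√(2 * (α * β)) * (d - c)) ≤
      ∫⁻ t in uIcc t₁ t₂, ENNReal.ofReal (1 - √(1 - (deriv u t) ^ 2) + a t * W (u t)) := by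
  set v : ℝ → ℝ := fun s => max c (min d (u s)) with hv
  have hvu : ∀ s t, |v s - v t| ≤ |u s - u t| := fun s t => abs_clamp_sub_clamp_le c d _ _
  have hvL : LipschitzWith 1 v := LipschitzWith.of_dist_le_mul fun s t =>
    (hvu s t).trans (hu.dist_le_mul s t)
  have hvar := hvL.ofReal_abs_sub_le_lintegral_deriv t₁ t₂
  have hval : |v t₂ - v t₁| = d - c := by
    simp [hv, h₁, h₂, hcd]
  rw [hval] at hvar
  rw [ENNReal.ofReal_mul (Real.sqrt_nonneg _)]
  refine (mul_le_mul_right hvar _).trans ?_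
  rw [← lintegral_const_mul _ (measurable_deriv v).abs.ennreal_ofReal]
  refine setLIntegral_mono_ae' measurableSet_uIcc ?_
  filter_upwards [hu.ae_differentiableAt_real] with t ht htI
  rw [← ENNReal.ofReal_mul (Real.sqrt_nonneg _)]
  refine ENNReal.ofReal_le_ofReal ?_
  have hat := ha t htI
  have hu1 : |deriv u t| ≤ 1 := by
    simpa using norm_deriv_le_of_lipschitz hu (x₀ := t)
  by_cases hmem : u t ∈ Icc c d
  · have hle := abs_deriv_le_abs_deriv_of_abs_sub_le ht fun s => hvu s t
    calc √(2 * (α * β)) * |deriv v t| ≤ √(2 * (α * β)) * |deriv u t| := by gcongr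
      _ ≤ 1 - √(1 - deriv u t ^ 2) + α * β := sqrt_two_mul_mul_le_lagrangian hu1 (by positivity)
      _ ≤ 1 - √(1 - deriv u t ^ 2) + a t * W (u t) := by
        gcongr
        · exact hα.trans hat
        · exact hWβ _ hmem
  · rw [deriv_clamp_eq_zero_of_notMem hu.continuous hcd hmem]
    have hs : √(1 - deriv u t ^ 2) ≤ 1 := Real.sqrt_le_one.2 (by nlinarith [sq_nonneg (deriv u t)])
    have := mul_nonneg (hα.trans hat) (hW (u t))
    simp only [abs_zero, mul_zero]
    linarith

lemma DoubleWell.nonneg {W : ℝ → ℝ} (hW : DoubleWell W) (s : ℝ) : 0 ≤ W s := by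
  obtain ⟨-, h0, h1, hpos⟩ := hW
  by_cases hm : s = -1
  · rw [hm, h0]
  by_cases hp : s = 1
  · rw [hp, h1]
  exact (hpos s hm hp).le

/-- Lower bound on the action of a transition layer: if `u ∈ X₁` passes
from `1 - ε` to `1 - ε/2` (or from `-1 + ε/2` to `-1 + ε`) between `t₁` and `t₂`, and
`a₁ := inf_{[t₁,t₂]} a > 0`, then the action on that interval, and hence `L_a(u)`, is at
least `ε √(a₁ β_ε) / √2`, where `β_ε` is the minimum of `W` on the two transition zones. -/
theorem action_lower_bound (W a : ℝ → ℝ) (hW : DoubleWell W) (hma : Measurable a)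
    (ε : ℝ) (hε : 0 < ε) (u : ℝ → ℝ) (hu : memX1 u) (t₁ t₂ : ℝ)
    (hval : (u t₁ = 1 - ε ∧ u t₂ = 1 - ε / 2) ∨ (u t₁ = -1 + ε / 2 ∧ u t₂ = -1 + ε))
    (ha₁ : 0 < sInf (a '' Set.uIcc t₁ t₂)) :
    ENNReal.ofReal (ε * Real.sqrt (sInf (a '' Set.uIcc t₁ t₂) *
        sInf (W '' (Set.Icc (1 - ε) (1 - ε / 2) ∪ Set.Icc (-1 + ε / 2) (-1 + ε))))
        / Real.sqrt 2)
      ≤ ∫⁻ t in Set.uIcc t₁ t₂,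
          ENNReal.ofReal (1 - Real.sqrt (1 - (deriv u t) ^ 2) + a t * W (u t)) ∧
    (∫⁻ t in Set.uIcc t₁ t₂,
        ENNReal.ofReal (1 - Real.sqrt (1 - (deriv u t) ^ 2) + a t * W (u t)))
      ≤ LaE a W u := by
  refine ⟨?_, setLIntegral_le_lintegral _ _⟩
  set α := sInf (a '' uIcc t₁ t₂)
  set S := Icc (1 - ε) (1 - ε / 2) ∪ Icc (-1 + ε / 2) (-1 + ε)
  set β := sInf (W '' S)
  have hbdd : BddBelow (a '' uIcc t₁ t₂) := by
    by_contra h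
    exact ha₁.ne' (Real.sInf_of_not_bddBelow h)
  have ha : ∀ t ∈ uIcc t₁ t₂, α ≤ a t := fun t ht => csInf_le hbdd (mem_image_of_mem a ht)
  have hβ : 0 ≤ β := Real.sInf_nonneg (by rintro _ ⟨s, -, rfl⟩; exact hW.nonneg s)
  have hWβ : ∀ s ∈ S, β ≤ W s := fun s hs =>
    csInf_le ⟨0, by rintro _ ⟨s, -, rfl⟩; exact hW.nonneg s⟩ (mem_image_of_mem W hs)
  have hcost : ε * √(α * β) / √2 = √(2 * (α * β)) * (ε / 2) := by
    rw [Real.sqrt_mul zero_le_two (α * β)]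
    field_simp
    rw [Real.sq_sqrt zero_le_two]
  rw [hcost]
  rcases hval with ⟨h₁, h₂⟩ | ⟨h₁, h₂⟩
  · convert ofReal_crossing_cost_le hu.1 hW.nonneg ha₁.le hβ ha
      (fun s hs => hWβ s (Or.inl hs)) (by linarith) h₁ h₂ using 3
    ring
  · convert ofReal_crossing_cost_le hu.1 hW.nonneg ha₁.le hβ ha
      (fun s hs => hWβ s (Or.inr hs)) (by linarith) h₁ h₂ using 3
    ring
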